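/- For every partition r⃗ = (r_0,…,r_m) ∈ R^n that does NOT belong to R^n(ε), one has E( LC*_n(r⃗) ) ≤ γ*_k·n − (γ*_k − γ^e_k)·n·p·ε. -/

import Mathlib

open scoped Classical ENNReal

/-- The length of a longest common subsequence (LCS) of two lists:
the maximal length of a list that is a sublist (subsequence) of both. -/
noncomputable def lcsLength {α : Type*} (x y : List α) : ℕ :=
  sSup {L : ℕ | ∃ z : List α, z.Sublist x ∧ z.Sublist y ∧ z.length = L}

/-- The string made of the first `n` letters of an infinite sequence of letters. -/
def strN {k : ℕ} (x : ℕ → Fin k) (n : ℕ) : List (Fin k) := (List.range n).map x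

/-- The score of the best alignment of `x` and `y` under the constraints given by the
partition `r`: block `i` of `x` (of length `2d`) is aligned with `y_{r i + 1} ⋯ y_{r (i+1)}`. -/
noncomputable def score {α : Type*} (d m : ℕ) (r : ℕ → ℕ) (x y : List α) : ℕ :=
  ∑ i ∈ Finset.range m,
    lcsLength ((x.drop (2*d*i)).take (2*d)) ((y.drop (r i)).take (r (i+1) - r i))

/-- `r` is a partition `0 = r 0 ≤ r 1 ≤ ⋯ ≤ r m = n` of `[0,n]` into `m` pieces. -/
def IsPartition (n m : ℕ) (r : ℕ → ℕ) : Prop :=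
  r 0 = 0 ∧ (∀ i, i < m → r i ≤ r (i + 1)) ∧ r m = n

/-- `t` lies in the interval `I_d = [2d(1-qe)/(1+qe), 2d(1+qe)/(1-qe)]`. -/
def inI (d : ℕ) (qe t : ℝ) : Prop :=
  2*(d:ℝ)*(1-qe)/(1+qe) ≤ t ∧ t ≤ 2*(d:ℝ)*(1+qe)/(1-qe)

/-- The number of pieces of the partition `r` whose length falls outside `I_d`. -/
noncomputable def badCount (d m : ℕ) (qe : ℝ) (r : ℕ → ℕ) : ℕ :=
  ((Finset.range m).filter (fun i => ¬ inI d qe ((r (i+1) : ℝ) - (r i : ℝ)))).card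

/-- Membership in `R^n(ε)`: `r` is a partition of `[0,n]` into `m` pieces with at most
`2 m p ε` of the lengths `r (i+1) - r i` outside the interval `I_d`. -/
noncomputable def memReps (d m : ℕ) (p ε qe : ℝ) (n : ℕ) (r : ℕ → ℕ) : Prop :=
  IsPartition n m r ∧ (badCount d m qe r : ℝ) ≤ 2*(m:ℝ)*p*ε

/-- Expected length of the LCS of two independent strings of lengths `a` and `b` of
iid letters uniform on a `k`-letter alphabet. -/
noncomputable def expLCS (k a b : ℕ) : ℝ :=
  (∑ x : Fin a → Fin k, ∑ y : Fin b → Fin k,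
    (lcsLength (List.ofFn x) (List.ofFn y) : ℝ)) / ((k : ℝ)^a * (k : ℝ)^b)

/-- The mean LCS-function `γ_k(q) = lim_n E|LCS(V_1⋯V_{n-nq}; W_1⋯W_{n+nq})|/n`
(the limit exists by superadditivity; we realize it as a `limsup`). -/
noncomputable def gammaLim (k : ℕ) (q : ℝ) : ℝ :=
  Filter.limsup
    (fun n : ℕ => expLCS k ((n : ℤ) - ⌊(n : ℝ) * q⌋).toNat ((n : ℤ) + ⌊(n : ℝ) * q⌋).toNat / n)
    Filter.atTop

/-- The uniform probability measure on a finite type. -/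
noncomputable def unifM (α : Type*) [MeasurableSpace α] [Fintype α] :
    MeasureTheory.Measure α :=
  (Fintype.card α : ℝ≥0∞)⁻¹ • MeasureTheory.Measure.count

/-- The Bernoulli(p) measure on `Bool`. -/
noncomputable def bern (p : ℝ) : MeasureTheory.Measure Bool :=
  ENNReal.ofReal p • MeasureTheory.Measure.dirac true
    + ENNReal.ofReal (1 - p) • MeasureTheory.Measure.dirac false

/-- `pos` (a 1-based position) belongs to the block interval
`J_{i+1} = [(2i+1)d - ℓ/2, (2i+1)d + ℓ/2]` (here `i` is 0-based). -/
def memJ (d l i pos : ℕ) : Prop :=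
  (2*i+1)*d ≤ pos + l/2 ∧ pos ≤ (2*i+1)*d + l/2

/-- The number of long blocks: the number of indices `i < m` with `Z i = true`. -/
noncomputable def numBlocks (m : ℕ) (Zω : ℕ → Bool) : ℕ :=
  ((Finset.range m).filter (fun i => Zω i = true)).card

/-- The (0-based) index of the `j`-th long block (`j` 1-based). -/
noncomputable def blockIdx (m : ℕ) (Zω : ℕ → Bool) (j : ℕ) : ℕ :=
  (((Finset.range m).filter (fun i => Zω i = true)).sort (· ≤ ·)).getD (j - 1) 0

theorem lcs_bdd {α : Type*} (x y : List α) :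
    BddAbove {L : ℕ | ∃ z : List α, z.Sublist x ∧ z.Sublist y ∧ z.length = L} :=
  ⟨x.length, by rintro L ⟨z, h1, _, rfl⟩; exact h1.length_le⟩

theorem lcs_exists {α : Type*} (x y : List α) :
    ∃ z : List α, z.Sublist x ∧ z.Sublist y ∧ z.length = lcsLength x y :=
  Nat.sSup_mem (s := {L : ℕ | ∃ z : List α, z.Sublist x ∧ z.Sublist y ∧ z.length = L})
    ⟨0, [], by simp⟩ (lcs_bdd x y)

theorem le_lcs {α : Type*} {x y z : List α} (h1 : z.Sublist x) (h2 : z.Sublist y) :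
    z.length ≤ lcsLength x y :=
  le_csSup (lcs_bdd x y) ⟨z, h1, h2, rfl⟩

theorem lcs_append {α : Type*} (x x' y y' : List α) :
    lcsLength x y + lcsLength x' y' ≤ lcsLength (x ++ x') (y ++ y') := by
  obtain ⟨z, h1, h2, h3⟩ := lcs_exists x y
  obtain ⟨z', h1', h2', h3'⟩ := lcs_exists x' y'
  rw [← h3, ← h3', ← List.length_append]
  exact le_lcs (h1.append h1') (h2.append h2')

theorem lcs_comm {α : Type*} (x y : List α) : lcsLength x y = lcsLength y x := by
  unfold lcsLength
  congr 1
  ext L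
  constructor <;> rintro ⟨z, h1, h2, h3⟩ <;> exact ⟨z, h2, h1, h3⟩

theorem lcs_le_left {α : Type*} (x y : List α) : lcsLength x y ≤ x.length := by
  obtain ⟨z, h1, h2, h3⟩ := lcs_exists x y
  rw [← h3]; exact h1.length_le

/-- Average of `F` over all strings of length `n`. -/
noncomputable def avg (k n : ℕ) (F : List (Fin k) → ℝ) : ℝ :=
  (∑ x : Fin n → Fin k, F (List.ofFn x)) / (k : ℝ)^n

theorem avg_const {k : ℕ} (hk : 0 < k) (n : ℕ) (c : ℝ) : avg k n (fun _ => c) = c := by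
  have : (k : ℝ) ≠ 0 := by positivity
  unfold avg
  simp
  field_simp

theorem avg_plus (k n : ℕ) (F G : List (Fin k) → ℝ) :
    avg k n (fun u => F u + G u) = avg k n F + avg k n G := by
  unfold avg
  rw [Finset.sum_add_distrib, add_div]

theorem avg_sum (k n : ℕ) {ι : Type*} (s : Finset ι) (F : ι → List (Fin k) → ℝ) :
    avg k n (fun u => ∑ i ∈ s, F i u) = ∑ i ∈ s, avg k n (F i) := by
  unfold avg
  rw [Finset.sum_comm, Finset.sum_div]

theorem avg_mono {k n : ℕ} {F G : List (Fin k) → ℝ}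
    (h : ∀ u : List (Fin k), u.length = n → F u ≤ G u) :
    avg k n F ≤ avg k n G := by
  unfold avg
  gcongr with x
  exact h _ (by simp)

theorem avg_congr {k n : ℕ} {F G : List (Fin k) → ℝ}
    (h : ∀ u : List (Fin k), u.length = n → F u = G u) :
    avg k n F = avg k n G :=
  le_antisymm (avg_mono fun u hu => (h u hu).le) (avg_mono fun u hu => (h u hu).ge)

theorem avg_append (k a b : ℕ) (F : List (Fin k) → ℝ) :
    avg k (a + b) F = avg k a (fun u => avg k b (fun v => F (u ++ v))) := by
  unfold avg
  rw [← Finset.sum_div, div_div, ← pow_add, add_comm b a]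
  congr 1
  rw [← Fintype.sum_prod_type', ← (Fin.appendEquiv a b).sum_comp]
  refine Finset.sum_congr rfl fun x _ => ?_
  change _ = F (List.ofFn x.1 ++ List.ofFn x.2)
  rw [← List.ofFn_fin_append]
  rfl

theorem avg_comm (k a b : ℕ) (F : List (Fin k) → List (Fin k) → ℝ) :
    avg k a (fun u => avg k b (fun v => F u v)) = avg k b (fun v => avg k a (fun u => F u v)) := by
  unfold avg
  rw [← Finset.sum_div, ← Finset.sum_div, Finset.sum_comm, div_right_comm]

theorem avg_segment {k : ℕ} (hk : 0 < k) (a b n : ℕ) (h : a + b ≤ n) (F : List (Fin k) → ℝ) :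
    avg k n (fun u => F ((u.drop a).take b)) = avg k b F := by
  obtain ⟨c, rfl⟩ := Nat.exists_eq_add_of_le h
  rw [avg_append, avg_append]
  have : ∀ u : List (Fin k), u.length = a →
      avg k b (fun v => avg k c (fun w => F (((u ++ v ++ w).drop a).take b))) = avg k b F := by
    intro u hu
    refine avg_congr fun v hv => ?_
    rw [← avg_const hk c (F v)]
    refine avg_congr fun w hw => ?_
    subst hu hv
    simp
  rw [avg_congr this, avg_const hk]

theorem expLCS_eq (k a b : ℕ) :
    expLCS k a b = avg k a (fun u => avg k b (fun v => (lcsLength u v : ℝ))) := by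
  unfold expLCS avg
  rw [← Finset.sum_div, div_div, mul_comm]

theorem expLCS_comm (k a b : ℕ) : expLCS k a b = expLCS k b a := by
  rw [expLCS_eq, expLCS_eq, avg_comm]
  simp only [lcs_comm]

theorem expLCS_nonneg (k a b : ℕ) : 0 ≤ expLCS k a b := by
  unfold expLCS; positivity

theorem expLCS_le_left {k : ℕ} (hk : 0 < k) (a b : ℕ) : expLCS k a b ≤ a := by
  rw [expLCS_eq]
  calc _ ≤ avg k a (fun u => avg k b (fun v => (a : ℝ))) := by
        refine avg_mono fun u hu => avg_mono fun v hv => ?_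
        rw [← hu]; exact_mod_cast lcs_le_left u v
    _ = a := by simp only [avg_const hk]

theorem expLCS_super {k : ℕ} (hk : 0 < k) (a a' b b' : ℕ) :
    expLCS k a b + expLCS k a' b' ≤ expLCS k (a + a') (b + b') := by
  have e1 : expLCS k a b = avg k a (fun u => avg k a' (fun u' => avg k b (fun v =>
      avg k b' (fun v' => (lcsLength u v : ℝ))))) := by
    simp only [avg_const hk]; exact expLCS_eq k a b
  have e2 : expLCS k a' b' = avg k a (fun u => avg k a' (fun u' => avg k b (fun v =>
      avg k b' (fun v' => (lcsLength u' v' : ℝ))))) := by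
    simp only [avg_const hk]; exact expLCS_eq k a' b'
  rw [e1, e2, expLCS_eq, avg_append]
  simp only [avg_append k b b', ← avg_plus]
  refine avg_mono fun u _ => avg_mono fun u' _ => avg_mono fun v _ => avg_mono fun v' _ => ?_
  exact_mod_cast lcs_append u u' v v'

theorem expLCS_mono {k : ℕ} (hk : 0 < k) {a a' b b' : ℕ} (ha : a ≤ a') (hb : b ≤ b') :
    expLCS k a b ≤ expLCS k a' b' := by
  obtain ⟨c, rfl⟩ := Nat.exists_eq_add_of_le ha
  obtain ⟨e, rfl⟩ := Nat.exists_eq_add_of_le hb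
  linarith [expLCS_super hk a c b e, expLCS_nonneg k c e]

theorem expLCS_mul {k : ℕ} (hk : 0 < k) (a b j : ℕ) :
    j * expLCS k a b ≤ expLCS k (j * a) (j * b) := by
  induction j with
  | zero => simpa using expLCS_nonneg k _ _
  | succ j ih =>
    have := expLCS_super hk (j * a) a (j * b) b
    rw [Nat.succ_mul, Nat.succ_mul]
    push_cast
    linarith

theorem expLCS_seq {k : ℕ} (hk : 0 < k) (a b : ℕ) (q : ℝ) (hs : 0 < a + b) (hab : a ≤ b)
    (hq : 0 ≤ q) (h : q * (a + b) ≤ b - a) (N : ℕ) :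
    (2 * N / (a + b) - 2) * expLCS k a b ≤
      expLCS k ((N : ℤ) - ⌊(N : ℝ) * q⌋).toNat ((N : ℤ) + ⌊(N : ℝ) * q⌋).toNat := by
  have hs' : (0 : ℝ) < a + b := by exact_mod_cast hs
  have hab' : (a : ℝ) ≤ b := by exact_mod_cast hab
  obtain ⟨v, hv0, hv1, hv⟩ : ∃ v : ℝ, 0 ≤ v ∧ v ≤ N / (a + b) ∧ v * (b - a) = N * q := by
    rcases hab'.eq_or_lt with he | hlt
    · refine ⟨0, le_rfl, by positivity, ?_⟩
      have : q = 0 := by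
        rw [he, sub_self] at h
        have : 0 < (b : ℝ) + b := by linarith
        nlinarith
      simp [this]
    · have hd : 0 < (b : ℝ) - a := by linarith
      refine ⟨N * q / (b - a), by positivity, ?_, by field_simp⟩
      rw [div_le_div_iff₀ hd hs', mul_assoc]
      gcongr
  have hw : (N / (a + b) : ℝ) * (a + b) = N := by field_simp
  set w : ℝ := N / (a + b) with hwdef
  set j := ⌊w + v⌋₊
  set l := ⌊w - v⌋₊
  have hj : (j : ℝ) ≤ w + v := Nat.floor_le (by linarith)
  have hl : (l : ℝ) ≤ w - v := Nat.floor_le (by linarith)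
  have hj' : w + v < j + 1 := Nat.lt_floor_add_one _
  have hl' : w - v < l + 1 := Nat.lt_floor_add_one _
  have ha0 : (0 : ℝ) ≤ a := by positivity
  have hb0 : (0 : ℝ) ≤ b := by positivity
  have h1 : j * a + l * b ≤ ((N : ℤ) - ⌊(N : ℝ) * q⌋).toNat := by
    have : ((j * a + l * b : ℕ) : ℤ) ≤ (N : ℤ) - ⌊(N : ℝ) * q⌋ := by
      have hf := Int.floor_le ((N : ℝ) * q)
      have : ((j * a + l * b : ℕ) : ℝ) ≤ (N : ℝ) - ⌊(N : ℝ) * q⌋ := by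
        push_cast
        nlinarith [mul_le_mul_of_nonneg_right hj ha0, mul_le_mul_of_nonneg_right hl hb0]
      exact_mod_cast this
    omega
  have h2 : j * b + l * a ≤ ((N : ℤ) + ⌊(N : ℝ) * q⌋).toNat := by
    have : ((j * b + l * a : ℕ) : ℤ) - N ≤ ⌊(N : ℝ) * q⌋ := by
      rw [Int.le_floor]
      push_cast
      nlinarith [mul_le_mul_of_nonneg_right hj hb0, mul_le_mul_of_nonneg_right hl ha0]
    omega
  have h3 := expLCS_mono hk h1 h2
  have h4 := expLCS_super hk (j * a) (l * b) (j * b) (l * a)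
  have h5 := expLCS_mul hk a b j
  have h6 := expLCS_mul hk b a l
  rw [expLCS_comm k b a] at h6
  have h7 : (2 * N / (a + b) - 2 : ℝ) ≤ j + l := by
    have : (2 * N / (a + b) : ℝ) = 2 * w := by rw [hwdef]; ring
    linarith
  nlinarith [mul_le_mul_of_nonneg_right h7 (expLCS_nonneg k a b)]

theorem expLCS_le_gamma {k : ℕ} (hk : 0 < k) (a b : ℕ) (q : ℝ) (hs : 0 < a + b) (hab : a ≤ b)
    (hq : 0 ≤ q) (h : q * (a + b) ≤ b - a) :
    expLCS k a b ≤ ((a + b) / 2 : ℝ) * gammaLim k q := by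
  have hs' : (0 : ℝ) < a + b := by exact_mod_cast hs
  have hf0 := expLCS_nonneg k a b
  have key : 2 / (a + b) * expLCS k a b ≤ gammaLim k q := by
    refine le_of_forall_lt fun c hc => ?_
    obtain ⟨c', hcc', hc'⟩ := exists_between hc
    refine lt_of_lt_of_le hcc' ?_
    have ht : Filter.Tendsto (fun N : ℕ => (2 / (a + b) - 2 / (N : ℝ)) * expLCS k a b)
        Filter.atTop (nhds ((2 / (a + b) - 0) * expLCS k a b)) :=
      (tendsto_const_nhds.sub (tendsto_const_div_atTop_nhds_zero_nat 2)).mul_const _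
    rw [sub_zero] at ht
    refine Filter.le_limsup_of_frequently_le ?_ ?_
    · apply Filter.Eventually.frequently
      filter_upwards [ht.eventually (lt_mem_nhds hc'), Filter.eventually_gt_atTop 0] with N hN hN0
      have hN0' : (0 : ℝ) < N := by exact_mod_cast hN0
      refine hN.le.trans ?_
      rw [le_div_iff₀ hN0']
      refine le_trans (le_of_eq ?_) (expLCS_seq hk a b q hs hab hq h N)
      field_simp
    · refine ⟨1, ?_⟩
      simp only [Filter.eventually_map]
      refine Filter.Eventually.of_forall fun N => ?_
      refine div_le_one_of_le₀ ?_ (by positivity)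
      refine (expLCS_le_left hk _ _).trans ?_
      have : 0 ≤ ⌊(N : ℝ) * q⌋ := Int.floor_nonneg.2 (by positivity)
      have : ((N : ℤ) - ⌊(N : ℝ) * q⌋).toNat ≤ N := by omega
      exact_mod_cast this
  rw [div_mul_eq_mul_div, div_le_iff₀ hs'] at key
  linarith

theorem expLCS_le_gamma' {k : ℕ} (hk : 0 < k) (a b : ℕ) (q : ℝ) (hs : 0 < a + b)
    (hq : 0 ≤ q) (h : q * (a + b) ≤ |(b : ℝ) - a|) :
    expLCS k a b ≤ ((a + b) / 2 : ℝ) * gammaLim k q := by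
  rcases le_total a b with hab | hab
  · have hab' : (a : ℝ) ≤ b := by exact_mod_cast hab
    rw [abs_of_nonneg (by linarith)] at h
    exact expLCS_le_gamma hk a b q hs hab hq h
  · have hab' : (b : ℝ) ≤ a := by exact_mod_cast hab
    rw [abs_of_nonpos (by linarith)] at h
    rw [expLCS_comm, add_comm (a : ℝ)]
    exact expLCS_le_gamma hk b a q (by omega) hab hq (by linarith)

theorem integral_unifM {k n : ℕ} (F : (Fin n → Fin k) → ℝ) :
    ∫ x, F x ∂(unifM (Fin n → Fin k)) = (∑ x, F x) / (k : ℝ)^n := by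
  unfold unifM
  rw [MeasureTheory.integral_smul_measure, MeasureTheory.integral_count]
  simp [div_eq_inv_mul]

theorem unifM_prob {k : ℕ} (hk : 0 < k) (n : ℕ) :
    MeasureTheory.IsProbabilityMeasure (unifM (Fin n → Fin k)) := by
  constructor
  unfold unifM
  haveI : Nonempty (Fin k) := ⟨⟨0, hk⟩⟩
  rw [MeasureTheory.Measure.smul_apply, MeasureTheory.Measure.count_apply MeasurableSet.univ]
  simp only [Set.encard_univ, ENat.card_eq_coe_fintype_card, smul_eq_mul]
  exact ENNReal.inv_mul_cancel (by simp [hk.ne']) (by simp)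

theorem strN_eq {k : ℕ} (x : ℕ → Fin k) (n : ℕ) :
    strN x n = List.ofFn (fun i : Fin n => x i) := by
  unfold strN
  apply List.ext_getElem <;> simp

/-- For every partition `r⃗ ∈ R^n` not in `R^n(ε)`,
`E LC*_n(r⃗) ≤ γ*_k n - (γ*_k - γ^e_k) n p ε` (inequality (0.5) of the paper),
where `X*` and `Y` are independent strings of `n = 2dm` iid uniform letters. -/
theorem expected_score_le_of_not_memReps
    {Ω : Type*} [MeasurableSpace Ω] (P : MeasureTheory.Measure Ω)
    [MeasureTheory.IsProbabilityMeasure P]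
    (k d m : ℕ) (hk : 2 ≤ k) (hd : 1 ≤ d) (hm : 1 ≤ m)
    (Xstar Y : Ω → ℕ → Fin k) (hmX : Measurable Xstar) (hmY : Measurable Y)
    (hlaw : MeasureTheory.Measure.map
        (fun ω => ((fun i : Fin (2*d*m) => Xstar ω i), (fun i : Fin (2*d*m) => Y ω i))) P
      = (unifM (Fin (2*d*m) → Fin k)).prod (unifM (Fin (2*d*m) → Fin k)))
    (γe p ε qe : ℝ) (hγe : γe < gammaLim k 0) (hqe : 0 < qe ∧ qe < 1)
    (hγqe : gammaLim k qe = γe) (hp : 0 < p ∧ p < 1) (hε : 0 < ε)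
    (r : ℕ → ℕ) (hr : IsPartition (2*d*m) m r)
    (hnot : ¬ memReps d m p ε qe (2*d*m) r) :
    ∫ ω, (score d m r (strN (Xstar ω) (2*d*m)) (strN (Y ω) (2*d*m)) : ℝ) ∂P
      ≤ gammaLim k 0 * (2*d*m : ℝ) - (gammaLim k 0 - γe) * (2*d*m : ℝ) * p * ε := by
  have hk0 : 0 < k := by omega
  haveI := unifM_prob hk0 (2*d*m)
  obtain ⟨hr0, hrm, hrn⟩ := hr
  have hmono : ∀ j, j ≤ m → ∀ i, i ≤ j → r i ≤ r j := by
    intro j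
    induction j with
    | zero => intro _ i hi; rw [Nat.le_zero.1 hi]
    | succ j ih =>
      intro hj i hi
      rcases Nat.lt_or_ge j i with h | h
      · rw [show i = j + 1 by omega]
      · exact (ih (by omega) i h).trans (hrm j (by omega))
  have hE : ∫ ω, (score d m r (strN (Xstar ω) (2*d*m)) (strN (Y ω) (2*d*m)) : ℝ) ∂P
      = ∑ i ∈ Finset.range m, expLCS k (2*d) (r (i+1) - r i) := by
    set φ : Ω → (Fin (2*d*m) → Fin k) × (Fin (2*d*m) → Fin k) :=
      (fun ω => ((fun i : Fin (2*d*m) => Xstar ω i), (fun i : Fin (2*d*m) => Y ω i)))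
    have hφ : Measurable φ := by
      refine Measurable.prodMk ?_ ?_
      · exact measurable_pi_lambda _ fun i => (measurable_pi_apply _).comp hmX
      · exact measurable_pi_lambda _ fun i => (measurable_pi_apply _).comp hmY
    set G : (Fin (2*d*m) → Fin k) × (Fin (2*d*m) → Fin k) → ℝ :=
      fun z => (score d m r (List.ofFn z.1) (List.ofFn z.2) : ℝ)
    have h1 : ∫ ω, (score d m r (strN (Xstar ω) (2*d*m)) (strN (Y ω) (2*d*m)) : ℝ) ∂P
        = ∫ z, G z ∂(MeasureTheory.Measure.map φ P) := by
      rw [MeasureTheory.integral_map hφ.aemeasurable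
        (Measurable.of_discrete).aestronglyMeasurable]
      simp only [strN_eq]
      rfl
    rw [h1, hlaw, MeasureTheory.integral_prod _ MeasureTheory.Integrable.of_finite]
    simp only [integral_unifM]
    change avg k (2*d*m) (fun u => avg k (2*d*m) (fun v => (score d m r u v : ℝ))) = _
    unfold score
    simp only [Nat.cast_sum, avg_sum]
    refine Finset.sum_congr rfl fun i hi => ?_
    have hi := Finset.mem_range.1 hi
    rw [expLCS_eq]
    have e1 : r i + (r (i+1) - r i) ≤ 2*d*m := by
      have := hmono m le_rfl (i+1) (by omega)
      have := hrm i hi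
      omega
    have e2 : 2*d*i + 2*d ≤ 2*d*m := by
      calc 2*d*i + 2*d = 2*d*(i+1) := by ring
        _ ≤ 2*d*m := Nat.mul_le_mul_left _ hi
    rw [← avg_segment hk0 (2*d*i) (2*d) (2*d*m) e2]
    refine avg_congr fun u _ => ?_
    exact avg_segment hk0 (r i) (r (i+1) - r i) (2*d*m) e1
      (fun v => (lcsLength ((u.drop (2*d*i)).take (2*d)) v : ℝ))
  rw [hE]
  have hd' : (1 : ℝ) ≤ d := by exact_mod_cast hd
  set Γ := gammaLim k 0
  have hblock : ∀ i ∈ Finset.range m, expLCS k (2*d) (r (i+1) - r i) ≤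
      (2 * d + ((r (i+1) : ℝ) - r i)) / 2 * Γ
        - (if ¬ inI d qe ((r (i+1) : ℝ) - (r i : ℝ)) then d * (Γ - γe) else 0) := by
    intro i hi
    have hle := hrm i (Finset.mem_range.1 hi)
    have hcast : ((r (i+1) - r i : ℕ) : ℝ) = (r (i+1) : ℝ) - r i := by
      rw [Nat.cast_sub hle]
    set t := r (i+1) - r i
    rw [← hcast]
    have ht0 : (0 : ℝ) ≤ t := by positivity
    split_ifs with hin
    · have := expLCS_le_gamma' hk0 (2*d) t 0 (by omega) le_rfl (by simp)
      push_cast at this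
      simpa using this
    · have := expLCS_le_gamma' hk0 (2*d) t qe (by omega) hqe.1.le (by
        push_cast
        by_contra! hcon
        apply hin
        rw [abs_lt] at hcon
        obtain ⟨hc1, hc2⟩ := hcon
        constructor
        · rw [div_le_iff₀ (by linarith)]; nlinarith
        · rw [le_div_iff₀ (by linarith)]; nlinarith)
      rw [hγqe] at this
      push_cast at this
      nlinarith
  refine (Finset.sum_le_sum hblock).trans ?_
  rw [Finset.sum_sub_distrib, ← Finset.sum_mul, ← Finset.sum_div, Finset.sum_add_distrib,
    Finset.sum_range_sub (fun i => (r i : ℝ)), hr0, hrn, ← Finset.sum_filter]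
  simp only [Finset.sum_const, Finset.card_range, nsmul_eq_mul]
  have hbad : 2*(m:ℝ)*p*ε < (badCount d m qe r : ℝ) := by
    by_contra! hcon
    exact hnot ⟨⟨hr0, hrm, hrn⟩, hcon⟩
  have hfin : 2*(m:ℝ)*p*ε * (d * (Γ - γe)) ≤ (badCount d m qe r : ℝ) * (d * (Γ - γe)) :=
    mul_le_mul_of_nonneg_right hbad.le (mul_nonneg (by linarith) (by linarith))
  unfold badCount at hfin
  push_cast
  linarith
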